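/- arXiv:2106.14300 — 6 statements merged into one kernel-verified Lean document; each statement's English description precedes it below -/
import Mathlib

section
/- For every integer C ≥ 2, every strictly positive finite joint pmf w on β × α, and every strictly positive similarity score S : β × α → ℝ, the Adversarial Soft kNN loss satisfies MI(w) ≥ -L(S) + log(C - 1). (This is Theorem 1 of the paper: the negative ASK loss, plus log(C-1), lower-bounds the mutual information between the perturbed input and its in-class reference data.) -/
open Finset

/-- Marginal of the perturbed input: `μ(x') = Σ_x w(x', x)`. -/
noncomputable def askMargMu {α β : Type*} [Fintype α] (w : β × α → ℝ) (x' : β) : ℝ :=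
  ∑ x : α, w (x', x)

/-- Marginal of the reference data: `m(x) = Σ_{x'} w(x', x)`. -/
noncomputable def askMargM {α β : Type*} [Fintype β] (w : β × α → ℝ) (x : α) : ℝ :=
  ∑ x' : β, w (x', x)

/-- Mutual information of a finite joint pmf `w` on `β × α`. -/
noncomputable def askMI {α β : Type*} [Fintype α] [Fintype β] (w : β × α → ℝ) : ℝ :=
  ∑ x' : β, ∑ x : α,
    w (x', x) * Real.log (w (x', x) / (askMargMu w x' * askMargM w x))

/-- The Adversarial Soft kNN (ASK) loss with `C` classes, joint pmf `w`, and
similarity score `S`: the expected negative log-softmax score of the in-class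
reference `x₁ ~ w(x', ·)/μ(x')` against `C-1` out-of-class references drawn
i.i.d. from the marginal `m`, with the perturbed input `x' ~ μ`. -/
noncomputable def askLoss {α β : Type*} [Fintype α] [Fintype β] (C : ℕ)
    (w : β × α → ℝ) (S : β × α → ℝ) : ℝ :=
  - ∑ x' : β, ∑ x₁ : α, ∑ t : Fin (C - 1) → α,
      w (x', x₁) * (∏ i, askMargM w (t i)) *
        Real.log (S (x', x₁) / (S (x', x₁) + ∑ i, S (x', t i)))

/-- For i.i.d. draws from `m`, the expected softmax share of the first of `n + 1` draws is
`1 / (n + 1)`, by exchangeability. -/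
lemma sum_prod_mul_softmax_zero {α : Type*} [Fintype α] (n : ℕ) (m s : α → ℝ)
    (hm : ∑ x, m x = 1) (hs : ∀ x, 0 < s x) :
    (n + 1 : ℝ) * ∑ u : Fin (n + 1) → α, (∏ i, m (u i)) * (s (u 0) / ∑ i, s (u i)) = 1 := by
  have hsymm : ∀ j : Fin (n + 1),
      ∑ u : Fin (n + 1) → α, (∏ i, m (u i)) * (s (u j) / ∑ i, s (u i)) =
        ∑ u : Fin (n + 1) → α, (∏ i, m (u i)) * (s (u 0) / ∑ i, s (u i)) := by
    intro j
    refine Fintype.sum_equiv ((Equiv.swap 0 j).arrowCongr (Equiv.refl α)) _ _ fun u => ?_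
    have hprod : ∏ i, m (u (Equiv.swap 0 j i)) = ∏ i, m (u i) :=
      Equiv.prod_comp (Equiv.swap 0 j) fun i => m (u i)
    have hsum : ∑ i, s (u (Equiv.swap 0 j i)) = ∑ i, s (u i) :=
      Equiv.sum_comp (Equiv.swap 0 j) fun i => s (u i)
    simp [Equiv.arrowCongr, hprod, hsum]
  calc
    _ = ∑ j : Fin (n + 1), ∑ u : Fin (n + 1) → α,
          (∏ i, m (u i)) * (s (u j) / ∑ i, s (u i)) := by
      simp [hsymm]
    _ = ∑ u : Fin (n + 1) → α, ∏ i, m (u i) := by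
      rw [Finset.sum_comm]
      refine Finset.sum_congr rfl fun u _ => ?_
      have hpos : 0 < ∑ i, s (u i) := Finset.sum_pos (fun i _ => hs _) Finset.univ_nonempty
      rw [← Finset.mul_sum, ← Finset.sum_div, div_self hpos.ne', mul_one]
    _ = 1 := by rw [← Fintype.sum_pow, hm, one_pow]

/-- The expected softmax share of `x` against `n` draws, all i.i.d. from `m`. -/
lemma sum_sum_prod_mul_softmax {α : Type*} [Fintype α] (n : ℕ) (m s : α → ℝ)
    (hm : ∑ x, m x = 1) (hs : ∀ x, 0 < s x) :
    (n + 1 : ℝ) * ∑ x, ∑ t : Fin n → α,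
      m x * (∏ i, m (t i)) * (s x / (s x + ∑ i, s (t i))) = 1 := by
  refine Eq.trans ?_ (sum_prod_mul_softmax_zero n m s hm hs)
  congr 1
  rw [← Fintype.sum_prod_type' fun x (t : Fin n → α) =>
    m x * (∏ i, m (t i)) * (s x / (s x + ∑ i, s (t i)))]
  refine Fintype.sum_equiv (Fin.consEquiv fun _ => α) _ _ fun p => ?_
  simp [Fin.consEquiv, Fin.prod_univ_succ, Fin.sum_univ_succ]

/-- The contrastive bound with the sharper constant `log (n + 1)` for `n` out-of-class
references. -/
lemma neg_askLoss_add_log_le_askMI {α β : Type*} [Fintype α] [Fintype β] (n : ℕ)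
    (w : β × α → ℝ) (hw_pos : ∀ p, 0 < w p) (hw_sum : ∑ p, w p = 1)
    (S : β × α → ℝ) (hS_pos : ∀ p, 0 < S p) :
    -askLoss (n + 1) w S + Real.log (n + 1) ≤ askMI w := by
  have hμ_sum : ∑ y, askMargMu w y = 1 := by
    simpa only [askMargMu, Fintype.sum_prod_type] using hw_sum
  have hm_sum : ∑ x, askMargM w x = 1 := by
    simpa only [askMargM, Fintype.sum_prod_type_right] using hw_sum
  have hμ_pos : ∀ y, ∀ _ : α, 0 < askMargMu w y := fun y x =>
    Finset.sum_pos (fun _ _ => hw_pos _) ⟨x, Finset.mem_univ x⟩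
  have hm_pos : ∀ x, ∀ _ : β, 0 < askMargM w x := fun x y =>
    Finset.sum_pos (fun _ _ => hw_pos _) ⟨y, Finset.mem_univ y⟩
  have hprod : ∑ t : Fin n → α, ∏ i, askMargM w (t i) = 1 := by
    rw [← Fintype.sum_pow, hm_sum, one_pow]
  have hexpand (f : β → α → ℝ) :
      ∑ y, ∑ x, ∑ t : Fin n → α, w (y, x) * (∏ i, askMargM w (t i)) * f y x =
        ∑ y, ∑ x, w (y, x) * f y x := by
    simp only [← Finset.sum_mul, ← Finset.mul_sum, hprod, mul_one]
  have hone : ∑ y, ∑ x, w (y, x) = 1 := by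
    rw [← Fintype.sum_prod_type]; exact hw_sum
  have hpoint (y : β) (x : α) (t : Fin n → α) :
      w (y, x) * (∏ i, askMargM w (t i)) *
          Real.log (S (y, x) / (S (y, x) + ∑ i, S (y, t i))) ≤
        w (y, x) * (∏ i, askMargM w (t i)) *
          (Real.log (w (y, x) / (askMargMu w y * askMargM w x)) - Real.log (n + 1) - 1) +
        askMargMu w y * ((n + 1) * (askMargM w x * (∏ i, askMargM w (t i)) *
          (S (y, x) / (S (y, x) + ∑ i, S (y, t i))))) := by
    have hw := hw_pos (y, x)
    have hμ := hμ_pos y x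
    have hm := hm_pos x y
    have hP : 0 < ∏ i, askMargM w (t i) := Finset.prod_pos fun i _ => hm_pos _ y
    have hσ : 0 < S (y, x) / (S (y, x) + ∑ i, S (y, t i)) :=
      div_pos (hS_pos _) (add_pos_of_pos_of_nonneg (hS_pos _)
        (Finset.sum_nonneg fun i _ => (hS_pos _).le))
    generalize S (y, x) / (S (y, x) + ∑ i, S (y, t i)) = σ at *
    generalize (∏ i, askMargM w (t i)) = P at *
    generalize askMargMu w y = a at *
    generalize askMargM w x = b at *
    generalize w (y, x) = v at *
    have hn : (0 : ℝ) < n + 1 := by positivity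
    have hr : 0 < v / (a * b) := by positivity
    have hlog := Real.log_le_sub_one_of_pos (show 0 < (n + 1) * σ / (v / (a * b)) by positivity)
    rw [Real.log_div (by positivity) hr.ne', Real.log_mul hn.ne' hσ.ne'] at hlog
    calc
      v * P * Real.log σ ≤ v * P * (Real.log (v / (a * b)) - Real.log (n + 1) - 1 +
          (n + 1) * σ / (v / (a * b))) := by
        gcongr
        linarith
      _ = _ := by field_simp
  have hsum := Finset.sum_le_sum fun y (_ : y ∈ Finset.univ) =>
    Finset.sum_le_sum fun x (_ : x ∈ Finset.univ) =>
      Finset.sum_le_sum fun t (_ : t ∈ Finset.univ) => hpoint y x t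
  have hshare (y : β) := sum_sum_prod_mul_softmax n (askMargM w) (fun x => S (y, x)) hm_sum
    fun x => hS_pos (y, x)
  simp only [Finset.sum_add_distrib, hexpand] at hsum
  simp only [← Finset.mul_sum, hshare, mul_one, hμ_sum] at hsum
  simp only [mul_sub, mul_one, Finset.sum_sub_distrib, ← Finset.sum_mul, hone, one_mul] at hsum
  have hloss := (neg_neg _).le.trans hsum
  change -askLoss (n + 1) w S ≤ askMI w - Real.log (n + 1) - 1 + 1 at hloss
  linarith

/-- **Theorem 1 (ASK paper).** For every integer `C ≥ 2`, every strictly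
positive finite joint pmf `w` on `β × α`, and every strictly positive
similarity score `S`, we have `MI(w) ≥ -L(S) + log (C - 1)`. -/
theorem ask_mutual_information_lower_bound
    {α β : Type*} [Fintype α] [Fintype β]
    (C : ℕ) (hC : 2 ≤ C)
    (w : β × α → ℝ) (hw_pos : ∀ p : β × α, 0 < w p)
    (hw_sum : ∑ p : β × α, w p = 1)
    (S : β × α → ℝ) (hS_pos : ∀ p : β × α, 0 < S p) :
    askMI w ≥ - askLoss C w S + Real.log ((C : ℝ) - 1) := by
  obtain ⟨n, rfl⟩ : ∃ n, C = n + 1 := ⟨C - 1, by omega⟩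
  have hn : (1 : ℝ) ≤ n := by exact_mod_cast (by omega : 1 ≤ n)
  have hlog : Real.log ((n + 1 : ℕ) - 1 : ℝ) ≤ Real.log (n + 1) :=
    Real.log_le_log (by push_cast; linarith) (by push_cast; linarith)
  linarith [neg_askLoss_add_log_le_askMI n w hw_pos hw_sum S hS_pos]
end

section
/- For every integer C ≥ 2 and every strictly positive finite joint pmf w on β × α, the mean-field ASK loss L̃ = Σ_{x', x} w(x', x) · Real.log( 1 + (C - 1) · μ(x') · m(x) / w(x', x) ) satisfies MI(w) ≥ -L̃ + log(C - 1). (This is the exact inequality established in steps (S4)–(S10) of the proof of Theorem 1, where the ASK loss is evaluated at the optimal density-ratio similarity and the sum of the out-of-class density ratios is replaced by its expectation C - 1.) -/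
open Finset

/-- The mean-field ASK loss
`L̃ = Σ_{x', x} w(x', x) · log( 1 + (C - 1) · μ(x') · m(x) / w(x', x) )`. -/
noncomputable def askLossMF {α β : Type*} [Fintype α] [Fintype β] (C : ℕ)
    (w : β × α → ℝ) : ℝ :=
  ∑ x' : β, ∑ x : α,
    w (x', x) *
      Real.log (1 + ((C : ℝ) - 1) * askMargMu w x' * askMargM w x / w (x', x))

theorem log_le_log_div_add_log_one_add {c p w : ℝ} (hc : 0 < c) (hp : 0 < p) (hw : 0 < w) :
    Real.log c ≤ Real.log (w / p) + Real.log (1 + c * p / w) := by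
  rw [← Real.log_mul (by positivity) (by positivity)]
  refine Real.log_le_log hc ?_
  have h : w / p * (1 + c * p / w) = w / p + c := by field_simp
  rw [h]
  exact le_add_of_nonneg_left (by positivity)

/-- Steps (S4)–(S10) of the proof of Theorem 1: for every integer `C ≥ 2` and
every strictly positive finite joint pmf `w`, the mean-field ASK loss `L̃`
satisfies `MI(w) ≥ -L̃ + log (C - 1)`. -/
theorem ask_meanfield_mutual_information_lower_bound
    {α β : Type*} [Fintype α] [Fintype β]
    (C : ℕ) (hC : 2 ≤ C)
    (w : β × α → ℝ) (hw_pos : ∀ p : β × α, 0 < w p)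
    (hw_sum : ∑ p : β × α, w p = 1) :
    askMI w ≥ - askLossMF C w + Real.log ((C : ℝ) - 1) := by
  have hC' : (0 : ℝ) < (C : ℝ) - 1 := by
    have : (2 : ℝ) ≤ C := by exact_mod_cast hC
    linarith
  rw [Fintype.sum_prod_type] at hw_sum
  suffices h : Real.log ((C : ℝ) - 1) ≤ askMI w + askLossMF C w by linarith
  calc Real.log ((C : ℝ) - 1)
      = ∑ x' : β, ∑ x : α, w (x', x) * Real.log ((C : ℝ) - 1) := by
        simp_rw [← Finset.sum_mul, hw_sum, one_mul]
    _ ≤ askMI w + askLossMF C w := by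
        simp_rw [askMI, askLossMF, ← Finset.sum_add_distrib, ← mul_add]
        refine Finset.sum_le_sum fun x' _ => Finset.sum_le_sum fun x _ =>
          mul_le_mul_of_nonneg_left ?_ (hw_pos _).le
        have hμ : 0 < askMargMu w x' := Finset.sum_pos (fun _ _ => hw_pos _) ⟨x, mem_univ x⟩
        have hm : 0 < askMargM w x := Finset.sum_pos (fun _ _ => hw_pos _) ⟨x', mem_univ x'⟩
        rw [mul_assoc ((C : ℝ) - 1)]
        exact log_le_log_div_add_log_one_add hC' (mul_pos hμ hm) (hw_pos _)
end

section
/- For every integer C ≥ 2 and every strictly positive finite joint pmf w on β × α, the density-ratio similarity r(x', x) = w(x', x) / (μ(x') · m(x)) minimizes the ASK loss: for every strictly positive similarity score S : β × α → ℝ, L(S) ≥ L(r). (This is the optimality claim 'any loss value is larger or equal to the optimal value' used in step (S2) of the proof of Theorem 1.) -/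
open Finset

/-- Gibbs' inequality for unnormalized positive weights. -/
theorem sum_mul_log_div_sum_le {ι : Type*} [Fintype ι] (r s : ι → ℝ)
    (hr : ∀ i, 0 < r i) (hs : ∀ i, 0 < s i) :
    ∑ i, r i * Real.log (s i / ∑ j, s j) ≤ ∑ i, r i * Real.log (r i / ∑ j, r j) := by
  rcases isEmpty_or_nonempty ι with _ | _
  · simp
  have hR : 0 < ∑ j, r j := Finset.sum_pos (fun i _ => hr i) Finset.univ_nonempty
  have hT : 0 < ∑ j, s j := Finset.sum_pos (fun i _ => hs i) Finset.univ_nonempty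
  have key : ∀ i, r i * Real.log (s i / ∑ j, s j) - r i * Real.log (r i / ∑ j, r j) ≤
      s i * ((∑ j, r j) / ∑ j, s j) - r i := by
    intro i
    have hri := hr i
    have hsi := hs i
    have hlog := Real.log_le_sub_one_of_pos
      (show 0 < (s i / ∑ j, s j) / (r i / ∑ j, r j) by positivity)
    rw [Real.log_div (by positivity) (by positivity)] at hlog
    calc _ = r i * (Real.log (s i / ∑ j, s j) - Real.log (r i / ∑ j, r j)) := by ring
      _ ≤ r i * ((s i / ∑ j, s j) / (r i / ∑ j, r j) - 1) := by gcongr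
      _ = _ := by field_simp
  have hsum := Finset.sum_le_sum fun i (_ : i ∈ Finset.univ) => key i
  rw [Finset.sum_sub_distrib, Finset.sum_sub_distrib, ← Finset.sum_mul,
    mul_div_cancel₀ _ hT.ne', sub_self] at hsum
  linarith

/-- If `F u a` is invariant under permutations of the tuple `u`, then the sum of `F u (u 0)`
over all tuples can be averaged over the coordinates of `u`. -/
theorem card_mul_sum_eq_sum_sum_of_symm {α : Type*} [Fintype α] {n : ℕ}
    (F : (Fin (n + 1) → α) → α → ℝ)
    (hF : ∀ (σ : Equiv.Perm (Fin (n + 1))) u a, F (u ∘ σ) a = F u a) :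
    ((n + 1 : ℕ) : ℝ) * ∑ u, F u (u 0) = ∑ u, ∑ j, F u (u j) := by
  have h : ∀ j, ∑ u, F u (u j) = ∑ u, F u (u 0) := by
    intro j
    refine Fintype.sum_equiv ((Equiv.swap 0 j).arrowCongr (Equiv.refl α)) _ _ fun u => ?_
    have hu : (Equiv.swap 0 j).arrowCongr (Equiv.refl α) u = u ∘ Equiv.swap 0 j := by
      ext; simp [Equiv.arrowCongr]
    rw [hu, hF]
    simp
  rw [Finset.sum_comm, Finset.sum_congr rfl fun j _ => h j]
  simp

/-- Splitting a sum over `(n + 1)`-tuples into the first entry and the rest. -/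
theorem sum_sum_cons {α : Type*} [Fintype α] {n : ℕ} (f : (Fin (n + 1) → α) → ℝ) :
    ∑ a, ∑ t : Fin n → α, f (Fin.cons a t) = ∑ u, f u := by
  rw [← Fintype.sum_prod_type' fun a (t : Fin n → α) => f (Fin.cons a t)]
  exact Fintype.sum_equiv (Fin.consEquiv fun _ => α) _ _ fun _ => rfl

/-- The ASK objective at a fixed perturbed input is maximized by the density ratio `r`. -/
theorem sum_mul_prod_mul_log_le {α : Type*} [Fintype α] (n : ℕ) (m r s : α → ℝ)
    (hm : ∀ a, 0 < m a) (hr : ∀ a, 0 < r a) (hs : ∀ a, 0 < s a) :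
    ∑ a, ∑ t : Fin n → α, r a * m a * (∏ i, m (t i)) * Real.log (s a / (s a + ∑ i, s (t i))) ≤
      ∑ a, ∑ t : Fin n → α,
        r a * m a * (∏ i, m (t i)) * Real.log (r a / (r a + ∑ i, r (t i))) := by
  have rewrite_sum : ∀ q : α → ℝ, ((n + 1 : ℕ) : ℝ) * ∑ a, ∑ t : Fin n → α,
        r a * m a * (∏ i, m (t i)) * Real.log (q a / (q a + ∑ i, q (t i))) =
      ∑ u : Fin (n + 1) → α,
        (∏ i, m (u i)) * ∑ j, r (u j) * Real.log (q (u j) / ∑ i, q (u i)) := by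
    intro q
    have h := card_mul_sum_eq_sum_sum_of_symm (α := α) (n := n)
      (fun u a => (∏ i, m (u i)) * (r a * Real.log (q a / ∑ i, q (u i)))) (by
        intro σ u a
        simp only [Function.comp_apply]
        rw [Equiv.prod_comp σ fun i => m (u i), Equiv.sum_comp σ fun i => q (u i)])
    simp only [← Finset.mul_sum] at h
    rw [← h, ← sum_sum_cons]
    congr 1
    refine Finset.sum_congr rfl fun a _ => Finset.sum_congr rfl fun t _ => ?_
    simp only [Fin.prod_univ_succ, Fin.sum_univ_succ, Fin.cons_zero, Fin.cons_succ]
    ring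
  refine le_of_mul_le_mul_left ?_ (show (0 : ℝ) < ((n + 1 : ℕ) : ℝ) by positivity)
  rw [rewrite_sum, rewrite_sum]
  refine Finset.sum_le_sum fun u _ => mul_le_mul_of_nonneg_left ?_
    (Finset.prod_nonneg fun i _ => (hm (u i)).le)
  exact sum_mul_log_div_sum_le (fun j => r (u j)) (fun j => s (u j))
    (fun j => hr (u j)) (fun j => hs (u j))

/-- Step (S2) of the proof of Theorem 1: the density-ratio similarity
`r(x', x) = w(x', x) / (μ(x') · m(x))` minimizes the ASK loss; every strictly
positive similarity score `S` satisfies `L(S) ≥ L(r)`. -/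
theorem ask_loss_density_ratio_optimal
    {α β : Type*} [Fintype α] [Fintype β]
    (C : ℕ) (hC : 2 ≤ C)
    (w : β × α → ℝ) (hw_pos : ∀ p : β × α, 0 < w p)
    (hw_sum : ∑ p : β × α, w p = 1)
    (S : β × α → ℝ) (hS_pos : ∀ p : β × α, 0 < S p) :
    askLoss C w S ≥
      askLoss C w (fun p => w p / (askMargMu w p.1 * askMargM w p.2)) := by
  have hm : ∀ (_ : β) (a : α), 0 < askMargM w a := fun b a =>
    Finset.sum_pos (fun _ _ => hw_pos _) ⟨b, Finset.mem_univ b⟩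
  have hμ : ∀ (b : β) (_ : α), 0 < askMargMu w b := fun b a =>
    Finset.sum_pos (fun _ _ => hw_pos _) ⟨a, Finset.mem_univ a⟩
  unfold askLoss
  refine neg_le_neg (Finset.sum_le_sum fun b _ => ?_)
  rcases isEmpty_or_nonempty α with _ | ⟨⟨a₀⟩⟩
  · simp
  have h := mul_le_mul_of_nonneg_left
    (sum_mul_prod_mul_log_le (C - 1) (askMargM w)
      (fun a => w (b, a) / (askMargMu w b * askMargM w a)) (fun a => S (b, a)) (hm b)
      (fun a => div_pos (hw_pos _) (mul_pos (hμ b a) (hm b a))) (fun a => hS_pos _))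
    (hμ b a₀).le
  have hw : ∀ a, w (b, a) =
      askMargMu w b * (w (b, a) / (askMargMu w b * askMargM w a) * askMargM w a) := by
    intro a
    have h₁ := (hμ b a).ne'
    have h₂ := (hm b a).ne'
    field_simp
  simp only [Finset.mul_sum, ← mul_assoc] at h hw
  simpa only [← hw] using h
end

section
/- For every integer C ≥ 2 and every strictly positive finite joint pmf w on β × α, the ASK loss at the density-ratio similarity r(x', x) = w(x', x) / (μ(x') · m(x)) is bounded above by the mean-field ASK loss: L(r) ≤ L̃, where L̃ = Σ_{x', x} w(x', x) · Real.log( 1 + (C - 1) · μ(x') · m(x) / w(x', x) ). (By concavity of the logarithm and the fact that the out-of-class density ratios have mean 1 under m, the expectation-substitution approximation in step (S6) of the proof of Theorem 1 never decreases the loss.) -/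
open Finset

/-- The product of `n` copies of a pmf has total mass one. -/
lemma sum_prod_eq_one_of_sum_eq_one {ι α : Type*} [Fintype ι] [DecidableEq ι] [Fintype α]
    {m : α → ℝ} (hm : ∑ x, m x = 1) : ∑ t : ι → α, ∏ i, m (t i) = 1 := by
  rw [← Fintype.prod_sum (fun (_ : ι) x => m x)]
  simp [hm]

/-- Under a product of copies of a pmf, each coordinate has the original expectation. -/
lemma sum_prod_mul_apply {ι α : Type*} [Fintype ι] [DecidableEq ι] [Fintype α]
    {m : α → ℝ} (hm : ∑ x, m x = 1) (f : α → ℝ) (j : ι) :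
    ∑ t : ι → α, (∏ i, m (t i)) * f (t j) = ∑ x, m x * f x := by
  have h (t : ι → α) : (∏ i, m (t i)) * f (t j)
      = ∏ i, m (t i) * if i = j then f (t i) else 1 := by
    rw [prod_mul_distrib, Fintype.prod_ite_eq']
  simp_rw [h]
  rw [← Fintype.prod_sum (fun i x => m x * if i = j then f x else 1),
    Fintype.prod_eq_single j fun i hi => by simp [hi, hm]]
  simp

/-- Jensen's inequality for the logarithm of a shifted sum of i.i.d. positive variables. -/
lemma sum_prod_mul_log_add_sum_le {ι α : Type*} [Fintype ι] [DecidableEq ι] [Fintype α]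
    {m f : α → ℝ} {a : ℝ} (hm0 : ∀ x, 0 ≤ m x) (hm : ∑ x, m x = 1)
    (hf : ∀ x, 0 ≤ f x) (ha : 0 < a) :
    ∑ t : ι → α, (∏ i, m (t i)) * Real.log (a + ∑ i, f (t i))
      ≤ Real.log (a + Fintype.card ι * ∑ x, m x * f x) := by
  have key := strictConcaveOn_log_Ioi.concaveOn.le_map_sum (t := univ)
    (w := fun t : ι → α => ∏ i, m (t i)) (p := fun t => a + ∑ i, f (t i))
    (fun t _ => prod_nonneg fun i _ => hm0 _) (sum_prod_eq_one_of_sum_eq_one hm)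
    (fun t _ => add_pos_of_pos_of_nonneg ha (sum_nonneg fun i _ => hf _))
  simp only [smul_eq_mul] at key
  refine key.trans_eq (congrArg Real.log ?_)
  simp_rw [mul_add, sum_add_distrib, ← sum_mul, mul_sum]
  rw [sum_prod_eq_one_of_sum_eq_one hm, sum_comm]
  simp_rw [sum_prod_mul_apply hm f]
  simp [mul_sum]

/-- Step (S6) of the proof of Theorem 1 never decreases the loss: the ASK loss
at the density-ratio similarity `r(x', x) = w(x', x) / (μ(x') · m(x))` is
bounded above by the mean-field ASK loss, `L(r) ≤ L̃`. -/
theorem ask_loss_density_ratio_le_meanfield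
    {α β : Type*} [Fintype α] [Fintype β]
    (C : ℕ) (hC : 2 ≤ C)
    (w : β × α → ℝ) (hw_pos : ∀ p : β × α, 0 < w p)
    (hw_sum : ∑ p : β × α, w p = 1) :
    askLoss C w (fun p => w p / (askMargMu w p.1 * askMargM w p.2)) ≤
      askLossMF C w := by
  have hm : ∑ x, askMargM w x = 1 := by
    simpa only [askMargM, Fintype.sum_prod_type_right] using hw_sum
  have hm_nonneg (x : α) : 0 ≤ askMargM w x := sum_nonneg fun _ _ => (hw_pos _).le
  have hm_pos (x' : β) (x : α) : 0 < askMargM w x :=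
    sum_pos (fun _ _ => hw_pos _) ⟨x', mem_univ _⟩
  have hμ_pos (x' : β) (x : α) : 0 < askMargMu w x' :=
    sum_pos (fun _ _ => hw_pos _) ⟨x, mem_univ _⟩
  have hmean (x' : β) (x₁ : α) :
      ∑ x, askMargM w x * (w (x', x) / (askMargMu w x' * askMargM w x)) = 1 := by
    have h (x : α) : askMargM w x * (w (x', x) / (askMargMu w x' * askMargM w x))
        = w (x', x) / askMargMu w x' := by
      have := hm_pos x' x
      have := hμ_pos x' x
      field_simp
    simp_rw [h, ← sum_div]
    exact div_self (hμ_pos x' x₁).ne'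
  unfold askLoss askLossMF
  simp_rw [← sum_neg_distrib]
  refine sum_le_sum fun x' _ => sum_le_sum fun x₁ _ => ?_
  have hw := hw_pos (x', x₁)
  have hμ := hμ_pos x' x₁
  have hm₁ := hm_pos x' x₁
  set f : α → ℝ := fun x => w (x', x) / (askMargMu w x' * askMargM w x) with hf_def
  have hf (x : α) : 0 < f x :=
    div_pos (hw_pos _) (mul_pos (hμ_pos x' x) (hm_pos x' x))
  have hlog (t : Fin (C - 1) → α) : Real.log (f x₁ / (f x₁ + ∑ i, f (t i)))
      = Real.log (f x₁) - Real.log (f x₁ + ∑ i, f (t i)) :=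
    Real.log_div (hf x₁).ne'
      (add_pos_of_pos_of_nonneg (hf x₁) (sum_nonneg fun i _ => (hf _).le)).ne'
  have hjensen := sum_prod_mul_log_add_sum_le (ι := Fin (C - 1)) hm_nonneg hm
    (fun x => (hf x).le) (hf x₁)
  rw [hmean x' x₁, mul_one, Fintype.card_fin, Nat.cast_sub (by lia), Nat.cast_one] at hjensen
  have hC' : (2 : ℝ) ≤ C := by exact_mod_cast hC
  have hratio : 1 + ((C : ℝ) - 1) * askMargMu w x' * askMargM w x₁ / w (x', x₁)
      = (f x₁ + ((C : ℝ) - 1)) / f x₁ := by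
    simp only [hf_def]
    field_simp
  calc ∑ t : Fin (C - 1) → α, -(w (x', x₁) * (∏ i, askMargM w (t i)) *
        Real.log (f x₁ / (f x₁ + ∑ i, f (t i))))
      = w (x', x₁) * (∑ t : Fin (C - 1) → α, (∏ i, askMargM w (t i)) *
          Real.log (f x₁ + ∑ i, f (t i)) - Real.log (f x₁)) := by
        rw [← one_mul (Real.log (f x₁)),
          ← sum_prod_eq_one_of_sum_eq_one (ι := Fin (C - 1)) hm, sum_mul,
          ← sum_sub_distrib, mul_sum]
        refine sum_congr rfl fun t _ => ?_
        rw [hlog]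
        ring
    _ ≤ w (x', x₁) * (Real.log (f x₁ + ((C : ℝ) - 1)) - Real.log (f x₁)) := by
        gcongr
    _ = _ := by
        rw [hratio, Real.log_div (by linarith [hf x₁]) (hf x₁).ne']
end

section
/- Let d, K ≥ 1, let g : β → EuclideanSpace ℝ (Fin d) and h : α → (Fin K → EuclideanSpace ℝ (Fin d)) be feature maps with g(x') ≠ 0 and h(a)(k) ≠ 0 for all x', a, k, and let τ > 0. Define the attack-form cosine ASK similarity S(x', a) = Real.exp( (1/(τ·K)) · Σ_{k ∈ Fin K} ⟪g(x'), h(a)(k)⟫ / (‖g(x')‖ · ‖h(a)(k)‖) ). Then for every integer C ≥ 2 and every strictly positive finite joint pmf w on β × α, MI(w) ≥ -L(S) + log(C - 1). (The ASK loss with the attack-form similarity S(·,·) = exp((1/K) Σ_k A(·,·)) built from τ-scaled cosine similarity on the layer-l feature embedding lower-bounds the mutual information, as asserted after Theorem 1.) -/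
open Finset

open scoped RealInnerProductSpace

/-- For i.i.d. samples, the expected share of each sample in a positive total is the same. -/
theorem sum_prod_mul_div_sum {α : Type*} [Fintype α] (m s : α → ℝ) (hm : ∑ a, m a = 1)
    (hs : ∀ a, 0 < s a) (n : ℕ) :
    ∑ a, ∑ t : Fin n → α, m a * (∏ i, m (t i)) * (s a / (s a + ∑ i, s (t i))) =
      1 / ((n : ℝ) + 1) := by
  set F : Fin (n + 1) → ℝ := fun j =>
    ∑ u : Fin (n + 1) → α, (∏ i, m (u i)) * (s (u j) / ∑ i, s (u i)) with hF
  have hcons : ∑ a, ∑ t : Fin n → α, m a * (∏ i, m (t i)) * (s a / (s a + ∑ i, s (t i))) =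
      F 0 := by
    simp only [hF]
    rw [← Fintype.sum_prod_type', ← (Fin.consEquiv fun _ : Fin (n + 1) => α).sum_comp]
    refine Finset.sum_congr rfl fun p _ => ?_
    simp [Fin.consEquiv, Fin.prod_univ_succ, Fin.sum_univ_succ]
  have hswap : ∀ j, F j = F 0 := by
    intro j
    simp only [hF]
    rw [← ((Equiv.swap 0 j).arrowCongr (Equiv.refl α)).sum_comp]
    refine Finset.sum_congr rfl fun u _ => ?_
    simp only [Equiv.arrowCongr_apply, Function.comp_apply, Equiv.refl_apply, Equiv.symm_swap,
      Equiv.swap_apply_right, Equiv.prod_comp (Equiv.swap 0 j) fun i => m (u i),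
      Equiv.sum_comp (Equiv.swap 0 j) fun i => s (u i)]
  have htotal : ∑ j, F j = 1 := by
    simp only [hF]
    rw [Finset.sum_comm]
    have hu : ∀ u : Fin (n + 1) → α,
        ∑ j, (∏ i, m (u i)) * (s (u j) / ∑ i, s (u i)) = ∏ i, m (u i) := by
      intro u
      have hpos : 0 < ∑ i, s (u i) := Finset.sum_pos (fun i _ => hs _) Finset.univ_nonempty
      rw [← Finset.mul_sum, ← Finset.sum_div, div_self hpos.ne', mul_one]
    simp_rw [hu]
    rw [← Fintype.sum_pow, hm, one_pow]
  simp only [hswap, Finset.sum_const, Finset.card_univ, Fintype.card_fin, nsmul_eq_mul] at htotal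
  push_cast at htotal
  rw [hcons, eq_div_iff (by positivity)]
  linarith

/-- The ASK loss of any positive similarity score lower-bounds the mutual information. -/
theorem askMI_ge_neg_askLoss_add_log {α β : Type*} [Fintype α] [Fintype β] (C : ℕ) (hC : 2 ≤ C)
    (w : β × α → ℝ) (hw_pos : ∀ p, 0 < w p) (hw_sum : ∑ p, w p = 1)
    (S : β × α → ℝ) (hS : ∀ p, 0 < S p) :
    askMI w ≥ - askLoss C w S + Real.log ((C : ℝ) - 1) := by
  obtain ⟨n, rfl⟩ : ∃ n, C = n + 1 := ⟨C - 1, by omega⟩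
  have hn : 0 < (n : ℝ) := by
    have : 0 < n := by omega
    exact_mod_cast this
  have hμ_sum : ∑ x', askMargMu w x' = 1 := by
    rw [← hw_sum, Fintype.sum_prod_type]; rfl
  have hm_sum : ∑ x, askMargM w x = 1 := by
    rw [← hw_sum, Fintype.sum_prod_type_right]; rfl
  have hμ (x' : β) (x : α) : 0 < askMargMu w x' :=
    Finset.sum_pos (fun _ _ => hw_pos _) ⟨x, Finset.mem_univ x⟩
  have hm (x' : β) (x : α) : 0 < askMargM w x :=
    Finset.sum_pos (fun _ _ => hw_pos _) ⟨x', Finset.mem_univ x'⟩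
  have hprod : ∑ t : Fin n → α, ∏ i, askMargM w (t i) = 1 := by
    rw [← Fintype.sum_pow, hm_sum, one_pow]
  have hmean : ∀ c : β → α → ℝ, ∑ x', ∑ x, w (x', x) * c x' x =
      ∑ x', ∑ x, ∑ t : Fin n → α, w (x', x) * (∏ i, askMargM w (t i)) * c x' x := by
    intro c
    refine Finset.sum_congr rfl fun x' _ => Finset.sum_congr rfl fun x _ => ?_
    rw [← Finset.sum_mul, ← Finset.mul_sum, hprod, mul_one]
  have hw_sum' : ∑ x', ∑ x, w (x', x) = 1 := by rw [← hw_sum, Fintype.sum_prod_type]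
  have hconst : ∀ c : ℝ, ∑ x', ∑ x, ∑ t : Fin n → α,
      w (x', x) * (∏ i, askMargM w (t i)) * c = c := by
    intro c
    rw [← hmean fun _ _ => c]
    simp_rw [← Finset.sum_mul]
    rw [hw_sum', one_mul]
  have hterm : ∀ (x' : β) (x : α) (t : Fin n → α),
      w (x', x) * (∏ i, askMargM w (t i)) *
          Real.log (S (x', x) / (S (x', x) + ∑ i, S (x', t i))) +
        w (x', x) * (∏ i, askMargM w (t i)) * Real.log n -
        w (x', x) * (∏ i, askMargM w (t i)) *
          Real.log (w (x', x) / (askMargMu w x' * askMargM w x)) ≤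
      n * (askMargMu w x' * (askMargM w x * (∏ i, askMargM w (t i)) *
        (S (x', x) / (S (x', x) + ∑ i, S (x', t i))))) -
        w (x', x) * (∏ i, askMargM w (t i)) * 1 := by
    intro x' x t
    have h1 := hw_pos (x', x)
    have h2 := hμ x' x
    have h3 := hm x' x
    have hP : 0 < ∏ i, askMargM w (t i) := Finset.prod_pos fun i _ => hm x' _
    have hf : 0 < S (x', x) / (S (x', x) + ∑ i, S (x', t i)) :=
      div_pos (hS _) (add_pos_of_pos_of_nonneg (hS _) (Finset.sum_nonneg fun i _ => (hS _).le))
    generalize S (x', x) / (S (x', x) + ∑ i, S (x', t i)) = f at *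
    generalize ∏ i, askMargM w (t i) = P at *
    generalize askMargMu w x' = u at *
    generalize askMargM w x = v at *
    generalize w (x', x) = q at *
    have hq : 0 < q / (u * v) := by positivity
    have hlog := Real.log_le_sub_one_of_pos (div_pos (mul_pos hf hn) hq)
    rw [Real.log_div (mul_pos hf hn).ne' hq.ne', Real.log_mul hf.ne' hn.ne'] at hlog
    have := mul_le_mul_of_nonneg_left hlog (mul_pos h1 hP).le
    have he : q * P * (f * n / (q / (u * v)) - 1) = n * (u * (v * P * f)) - q * P * 1 := by
      field_simp
    rw [he] at this
    linarith
  have hMI : askMI w = _ :=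
    hmean fun x' x => Real.log (w (x', x) / (askMargMu w x' * askMargM w x))
  have hsum := Finset.sum_le_sum fun x' (_ : x' ∈ Finset.univ) =>
    Finset.sum_le_sum fun x (_ : x ∈ Finset.univ) =>
      Finset.sum_le_sum fun t (_ : t ∈ Finset.univ) => hterm x' x t
  simp only [Finset.sum_add_distrib, Finset.sum_sub_distrib, hconst, ← hMI] at hsum
  simp only [← Finset.mul_sum] at hsum
  have hshare : ∀ x', ∑ x, ∑ t : Fin n → α, askMargM w x * (∏ i, askMargM w (t i)) *
      (S (x', x) / (S (x', x) + ∑ i, S (x', t i))) = 1 / ((n : ℝ) + 1) := fun x' =>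
    sum_prod_mul_div_sum (askMargM w) (fun x => S (x', x)) hm_sum (fun _ => hS _) n
  simp only [hshare, ← Finset.sum_mul, hμ_sum] at hsum
  have hle : (n : ℝ) * (1 * (1 / ((n : ℝ) + 1))) ≤ 1 := by
    rw [one_mul, mul_one_div, div_le_one (by positivity)]
    linarith
  have hloss : askLoss (n + 1) w S = -∑ x', ∑ x, ∑ t : Fin n → α,
      w (x', x) * (∏ i, askMargM w (t i)) *
        Real.log (S (x', x) / (S (x', x) + ∑ i, S (x', t i))) := rfl
  rw [hloss, neg_neg, Nat.cast_succ, add_sub_cancel_right]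
  linarith

/-- The ASK loss with the attack-form similarity
`S(x', a) = exp( (1/(τ·K)) · Σ_k ⟪g x', h a k⟫ / (‖g x'‖ · ‖h a k‖) )`
(built from τ-scaled cosine similarity on the layer-`l` feature embedding)
lower-bounds the mutual information: `MI(w) ≥ -L(S) + log (C - 1)`. -/
theorem ask_cosine_attack_similarity_lower_bound
    {α β : Type*} [Fintype α] [Fintype β]
    (d K : ℕ) (hd : 1 ≤ d) (hK : 1 ≤ K)
    (g : β → EuclideanSpace ℝ (Fin d))
    (h : α → (Fin K → EuclideanSpace ℝ (Fin d)))
    (hg : ∀ x' : β, g x' ≠ 0) (hh : ∀ (a : α) (k : Fin K), h a k ≠ 0)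
    (τ : ℝ) (hτ : 0 < τ)
    (C : ℕ) (hC : 2 ≤ C)
    (w : β × α → ℝ) (hw_pos : ∀ p : β × α, 0 < w p)
    (hw_sum : ∑ p : β × α, w p = 1) :
    askMI w ≥
      - askLoss C w (fun p =>
          Real.exp ((1 / (τ * K)) *
            ∑ k : Fin K, ⟪g p.1, h p.2 k⟫ / (‖g p.1‖ * ‖h p.2 k‖))) +
        Real.log ((C : ℝ) - 1) := by
  exact askMI_ge_neg_askLoss_add_log C hC w hw_pos hw_sum _ fun _ => Real.exp_pos _
end

section
/- Let d, K ≥ 1, let g : β → EuclideanSpace ℝ (Fin d) and h : α → (Fin K → EuclideanSpace ℝ (Fin d)) be feature maps, and let τ > 0. Define the defense-form negative-ℓ2 ASK similarity S(x', a) = Σ_{k ∈ Fin K} Real.exp( -‖g(x') - h(a)(k)‖ / τ ). Then for every integer C ≥ 2 and every strictly positive finite joint pmf w on β × α, MI(w) ≥ -L(S) + log(C - 1). (The ASK loss with the defense-form similarity S(·,·) = Σ_k exp(A(·,·)) built from τ-scaled negative Euclidean distance on the layer-l feature embedding lower-bounds the mutual information, as asserted after Theorem 1.) -/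
open Finset

theorem sum_askMargM {α β : Type*} [Fintype α] [Fintype β] (w : β × α → ℝ) :
    ∑ x, askMargM w x = ∑ p, w p := by
  rw [Fintype.sum_prod_type_right]
  rfl

theorem sum_askMargMu {α β : Type*} [Fintype α] [Fintype β] (w : β × α → ℝ) :
    ∑ x', askMargMu w x' = ∑ p, w p := by
  rw [Fintype.sum_prod_type]
  rfl

theorem sum_prod_apply_eq_one {α : Type*} [Fintype α] {m : α → ℝ} (hm : ∑ x, m x = 1)
    (n : ℕ) : ∑ t : Fin n → α, ∏ i, m (t i) = 1 := by
  classical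
  rw [← Fintype.piFinset_univ, ← Finset.prod_univ_sum]
  simp [hm]

/-- Among `n + 1` i.i.d. samples, the expected share of the first one in the total score is
`1 / (n + 1)`, by exchangeability. -/
theorem sum_mul_score_share {α : Type*} [Fintype α] {m s : α → ℝ} (hm : ∑ x, m x = 1)
    (hs : ∀ x, 0 < s x) (n : ℕ) :
    ∑ x, ∑ t : Fin n → α, m x * (∏ i, m (t i)) * (s x / (s x + ∑ i, s (t i))) =
      1 / ((n : ℝ) + 1) := by
  let F : Fin (n + 1) → ℝ := fun j =>
    ∑ u : Fin (n + 1) → α, (∏ i, m (u i)) * (s (u j) / ∑ i, s (u i))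
  have hF : ∀ j, F j = F 0 := by
    intro j
    refine Fintype.sum_equiv (Equiv.arrowCongr (Equiv.swap 0 j) (Equiv.refl α)) _ _ fun u => ?_
    have h₁ := Equiv.prod_comp (Equiv.swap 0 j) fun i => m (u i)
    have h₂ := Equiv.sum_comp (Equiv.swap 0 j) fun i => s (u i)
    simp [Equiv.arrowCongr, h₁, h₂]
  have hsum : ∑ j, F j = 1 := by
    rw [Finset.sum_comm, ← sum_prod_apply_eq_one hm (n + 1)]
    refine Finset.sum_congr rfl fun u _ => ?_
    have hpos : 0 < ∑ i, s (u i) :=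
      Finset.sum_pos (fun i _ => hs _) Finset.univ_nonempty
    rw [← Finset.mul_sum, ← Finset.sum_div, div_self hpos.ne', mul_one]
  have hzero : F 0 =
      ∑ x, ∑ t : Fin n → α, m x * (∏ i, m (t i)) * (s x / (s x + ∑ i, s (t i))) := by
    rw [← Fintype.sum_prod_type']
    refine (Fintype.sum_equiv (Fin.consEquiv fun _ => α) _ _ fun p => ?_).symm
    simp [Fin.consEquiv, Fin.prod_univ_succ, Fin.sum_univ_succ]
  rw [← hzero, eq_div_iff (by positivity)]
  simp only [hF, Finset.sum_const, Finset.card_univ, Fintype.card_fin, nsmul_eq_mul] at hsum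
  push_cast at hsum
  linarith

theorem mul_log_le_mul_log_div_add {w c q N : ℝ} (hw : 0 < w) (hc : 0 < c) (hq : 0 < q)
    (hN : 0 < N) :
    w * (Real.log q + Real.log N) ≤ w * Real.log (w / c) + (N * (c * q) - w) := by
  have key := Real.log_le_sub_one_of_pos (show 0 < q * N / (w / c) by positivity)
  rw [Real.log_div (by positivity) (by positivity), Real.log_mul hq.ne' hN.ne'] at key
  have := mul_le_mul_of_nonneg_left key hw.le
  have e : w * (q * N / (w / c) - 1) = N * (c * q) - w := by field_simp
  linarith

/-- The InfoNCE-type bound: `log C - L(S) ≤ MI(w)` for every positive score `S`, with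
`C = n + 1`. -/
theorem log_sub_askLoss_le_askMI {α β : Type*} [Fintype α] [Fintype β] (n : ℕ)
    {w : β × α → ℝ} (hw_pos : ∀ p, 0 < w p) (hw_sum : ∑ p, w p = 1)
    {S : β × α → ℝ} (hS : ∀ p, 0 < S p) :
    Real.log ((n : ℝ) + 1) - askLoss (n + 1) w S ≤ askMI w := by
  have hM : ∑ x, askMargM w x = 1 := (sum_askMargM w).trans hw_sum
  have hMu : ∑ x', askMargMu w x' = 1 := (sum_askMargMu w).trans hw_sum
  have hP := sum_prod_apply_eq_one hM n
  have hw_sum' : ∑ x', ∑ x, w (x', x) = 1 := by rw [← Fintype.sum_prod_type, hw_sum]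
  have hMu_pos (x' : β) (x : α) : 0 < askMargMu w x' :=
    Finset.sum_pos (fun _ _ => hw_pos _) ⟨x, Finset.mem_univ _⟩
  have hM_pos (x' : β) (x : α) : 0 < askMargM w x :=
    Finset.sum_pos (fun _ _ => hw_pos _) ⟨x', Finset.mem_univ _⟩
  let P : (Fin n → α) → ℝ := fun t => ∏ i, askMargM w (t i)
  let q : β → α → (Fin n → α) → ℝ := fun x' x t =>
    S (x', x) / (S (x', x) + ∑ i, S (x', t i))
  have pointwise (x' : β) (x : α) (t : Fin n → α) :
      w (x', x) * P t * Real.log (q x' x t) + P t * (w (x', x) * Real.log ((n : ℝ) + 1)) ≤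
        P t * (w (x', x) * Real.log (w (x', x) / (askMargMu w x' * askMargM w x)))
        + (((n : ℝ) + 1) * (askMargMu w x' * (askMargM w x * P t * q x' x t))
          - P t * w (x', x)) := by
    have hq : 0 < q x' x t :=
      div_pos (hS _) (add_pos_of_pos_of_nonneg (hS _) (Finset.sum_nonneg fun _ _ => (hS _).le))
    have hPt : 0 ≤ P t := Finset.prod_nonneg fun i _ => (hM_pos x' _).le
    have := mul_le_mul_of_nonneg_left
      (mul_log_le_mul_log_div_add (hw_pos (x', x)) (mul_pos (hMu_pos x' x) (hM_pos x' x)) hq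
        (show (0 : ℝ) < n + 1 by positivity)) hPt
    linarith
  have total := Finset.sum_le_sum fun x' (_ : x' ∈ Finset.univ) =>
    Finset.sum_le_sum fun x (_ : x ∈ Finset.univ) =>
      Finset.sum_le_sum fun t (_ : t ∈ Finset.univ) => pointwise x' x t
  have share (x' : β) : ∑ x, ∑ t, askMargM w x * P t * q x' x t = 1 / ((n : ℝ) + 1) :=
    sum_mul_score_share hM (fun x => hS (x', x)) n
  have hPsum : ∑ t, P t = 1 := hP
  simp only [Finset.sum_add_distrib, Finset.sum_sub_distrib, ← Finset.mul_sum,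
    ← Finset.sum_mul, hPsum, one_mul, hw_sum', share, hMu] at total
  have hN : ((n : ℝ) + 1) * (1 / (n + 1)) = 1 := by field_simp
  rw [hN] at total
  have hL : askLoss (n + 1) w S =
      -∑ x', ∑ x, ∑ t : Fin n → α, w (x', x) * P t * Real.log (q x' x t) := rfl
  rw [hL, askMI]
  linarith

/-- The ASK loss with the defense-form similarity
`S(x', a) = Σ_k exp( -‖g x' - h a k‖ / τ )` (built from τ-scaled negative
Euclidean distance on the layer-`l` feature embedding) lower-bounds the
mutual information: `MI(w) ≥ -L(S) + log (C - 1)`. -/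
theorem ask_l2_defense_similarity_lower_bound
    {α β : Type*} [Fintype α] [Fintype β]
    (d K : ℕ) (hd : 1 ≤ d) (hK : 1 ≤ K)
    (g : β → EuclideanSpace ℝ (Fin d))
    (h : α → (Fin K → EuclideanSpace ℝ (Fin d)))
    (τ : ℝ) (hτ : 0 < τ)
    (C : ℕ) (hC : 2 ≤ C)
    (w : β × α → ℝ) (hw_pos : ∀ p : β × α, 0 < w p)
    (hw_sum : ∑ p : β × α, w p = 1) :
    askMI w ≥
      - askLoss C w (fun p =>
          ∑ k : Fin K, Real.exp (-‖g p.1 - h p.2 k‖ / τ)) +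
        Real.log ((C : ℝ) - 1) := by
  have hK' : Nonempty (Fin K) := ⟨⟨0, hK⟩⟩
  obtain ⟨n, rfl⟩ : ∃ n, C = n + 1 := ⟨C - 1, by omega⟩
  have hn : (1 : ℝ) ≤ n := by exact_mod_cast (by omega : 1 ≤ n)
  have bound := log_sub_askLoss_le_askMI n hw_pos hw_sum
    (S := fun p => ∑ k : Fin K, Real.exp (-‖g p.1 - h p.2 k‖ / τ))
    fun p => Finset.sum_pos (fun _ _ => Real.exp_pos _) Finset.univ_nonempty
  have hlog : Real.log (((n + 1 : ℕ) : ℝ) - 1) ≤ Real.log ((n : ℝ) + 1) :=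
    Real.log_le_log (by push_cast; linarith) (by push_cast; linarith)
  linarith
end
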